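/- arXiv:2101.03950 — 2 statements merged into one kernel-verified Lean document; each statement's English description precedes it below -/
import Mathlib

section
/- Let δ > 0, let w ∈ ℝ², and let g : [0, δ] → ℝ be a measurable function such that r ↦ r²·|g(r)| is integrable on (0, δ). Then the vector-valued integral over the closed disk B_δ(0) = {z ∈ ℝ² : ‖z‖ ≤ δ} satisfies ∫_{B_δ(0)} g(‖z‖)·(z/‖z‖)·⟨w, z⟩ dz = π·(∫₀^δ r²·g(r) dr)·w, where ⟨·,·⟩ denotes the Euclidean inner product on ℝ² and the integrand is extended by 0 at z = 0. -/
open MeasureTheory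

lemma rmi_angle (w : EuclideanSpace ℝ (Fin 2)) :
    (∫ t in Set.Ioo (-Real.pi) Real.pi,
      (w 0 * Real.cos t + w 1 * Real.sin t) • (!₂[Real.cos t, Real.sin t] : EuclideanSpace ℝ (Fin 2)))
      = Real.pi • w := by
  have hpi : -Real.pi ≤ Real.pi := by linarith [Real.pi_pos]
  rw [← integral_Ioc_eq_integral_Ioo, ← intervalIntegral.integral_of_le hpi]
  have hc : Continuous (fun t : ℝ => (w 0 * Real.cos t + w 1 * Real.sin t) •
      (!₂[Real.cos t, Real.sin t] : EuclideanSpace ℝ (Fin 2))) := by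
    refine Continuous.fun_smul (by fun_prop) ?_
    apply (PiLp.continuous_toLp 2 _).comp
    refine continuous_pi fun i => ?_
    fin_cases i
    · exact Real.continuous_cos
    · exact Real.continuous_sin
  have key : ∀ i : Fin 2, (∫ t in (-Real.pi)..Real.pi, (w 0 * Real.cos t + w 1 * Real.sin t) •
      (!₂[Real.cos t, Real.sin t] : EuclideanSpace ℝ (Fin 2))) i
      = ∫ t in (-Real.pi)..Real.pi, ((w 0 * Real.cos t + w 1 * Real.sin t) •
      (!₂[Real.cos t, Real.sin t] : EuclideanSpace ℝ (Fin 2))) i := fun i =>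
    ((EuclideanSpace.proj (𝕜 := ℝ) i).intervalIntegral_comp_comm
      (hc.intervalIntegrable _ _)).symm
  have h1 : ∫ t in (-Real.pi)..Real.pi, Real.cos t ^ 2 = Real.pi := by
    rw [integral_cos_sq]; simp
  have h2 : ∫ t in (-Real.pi)..Real.pi, Real.sin t ^ 2 = Real.pi := by
    rw [integral_sin_sq]; simp
  have h3 : ∫ t in (-Real.pi)..Real.pi, Real.sin t * Real.cos t = 0 := by
    rw [integral_sin_mul_cos₁]; simp
  have i1 : IntervalIntegrable (fun t => Real.cos t ^ 2) volume (-Real.pi) Real.pi :=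
    Continuous.intervalIntegrable (by fun_prop) _ _
  have i2 : IntervalIntegrable (fun t => Real.sin t ^ 2) volume (-Real.pi) Real.pi :=
    Continuous.intervalIntegrable (by fun_prop) _ _
  have i3 : IntervalIntegrable (fun t => Real.sin t * Real.cos t) volume (-Real.pi) Real.pi :=
    Continuous.intervalIntegrable (by fun_prop) _ _
  ext i
  rw [key]
  fin_cases i
  · have : ∀ t : ℝ, ((w 0 * Real.cos t + w 1 * Real.sin t) •
      (!₂[Real.cos t, Real.sin t] : EuclideanSpace ℝ (Fin 2))) 0
      = w 0 * Real.cos t ^ 2 + w 1 * (Real.sin t * Real.cos t) := by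
      intro t; simp; ring
    simp only [Fin.zero_eta, this]
    rw [intervalIntegral.integral_add (i1.const_mul _) (i3.const_mul _),
      intervalIntegral.integral_const_mul, intervalIntegral.integral_const_mul, h1, h3]
    simp; ring
  · have : ∀ t : ℝ, ((w 0 * Real.cos t + w 1 * Real.sin t) •
      (!₂[Real.cos t, Real.sin t] : EuclideanSpace ℝ (Fin 2))) 1
      = w 0 * (Real.sin t * Real.cos t) + w 1 * Real.sin t ^ 2 := by
      intro t; simp; ring
    simp only [Fin.mk_one, this]
    rw [intervalIntegral.integral_add (i3.const_mul _) (i2.const_mul _),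
      intervalIntegral.integral_const_mul, intervalIntegral.integral_const_mul, h2, h3]
    simp; ring

lemma rmi_polar (F : EuclideanSpace ℝ (Fin 2) → EuclideanSpace ℝ (Fin 2)) :
    ∫ z, F z = ∫ p in Set.Ioi (0:ℝ) ×ˢ Set.Ioo (-Real.pi) Real.pi,
      p.1 • F !₂[p.1 * Real.cos p.2, p.1 * Real.sin p.2] := by
  rw [← (PiLp.volume_preserving_toLp (Fin 2)).integral_comp
      (MeasurableEquiv.toLp 2 (Fin 2 → ℝ)).measurableEmbedding,
    ← ((volume_preserving_finTwoArrow ℝ).symm _).integral_comp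
      (MeasurableEquiv.finTwoArrow (α := ℝ)).symm.measurableEmbedding,
    ← integral_comp_polarCoord_symm]
  rfl

/-- Radial-moment identity: for a radial weight `g` on the closed disk of radius `δ` in ℝ²,
`∫_{B_δ(0)} g(‖z‖)·(z/‖z‖)·⟨w,z⟩ dz = π·(∫₀^δ r²·g(r) dr)·w`. -/
theorem radial_moment_identity (δ : ℝ) (hδ : 0 < δ)
    (w : EuclideanSpace ℝ (Fin 2)) (g : ℝ → ℝ) (hg : Measurable g)
    (hint : IntegrableOn (fun r : ℝ => r ^ 2 * |g r|) (Set.Ioo 0 δ)) :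
    (∫ z in Metric.closedBall (0 : EuclideanSpace ℝ (Fin 2)) δ,
        ((g ‖z‖ * (inner ℝ w z : ℝ)) / ‖z‖) • z)
      = (Real.pi * ∫ r in (0:ℝ)..δ, r ^ 2 * g r) • w := by
  rw [← integral_indicator Metric.isClosed_closedBall.measurableSet, rmi_polar]
  have hcong : ∀ p ∈ Set.Ioi (0:ℝ) ×ˢ Set.Ioo (-Real.pi) Real.pi,
      p.1 • (Metric.closedBall (0 : EuclideanSpace ℝ (Fin 2)) δ).indicator
        (fun z => ((g ‖z‖ * (inner ℝ w z : ℝ)) / ‖z‖) • z)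
        !₂[p.1 * Real.cos p.2, p.1 * Real.sin p.2]
      = (Set.Iic δ).indicator (fun r => r ^ 2 * g r) p.1 •
        ((w 0 * Real.cos p.2 + w 1 * Real.sin p.2) •
          (!₂[Real.cos p.2, Real.sin p.2] : EuclideanSpace ℝ (Fin 2))) := by
    rintro ⟨r, t⟩ ⟨hr, -⟩
    have hr : 0 < r := hr
    have hn : ‖(!₂[r * Real.cos t, r * Real.sin t] : EuclideanSpace ℝ (Fin 2))‖ = r := by
      rw [EuclideanSpace.norm_eq, Real.sqrt_eq_iff_mul_self_eq (by positivity) hr.le]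
      simp only [Fin.sum_univ_two, Real.norm_eq_abs, sq_abs]
      simp
      linear_combination (r ^ 2) * Real.sin_sq_add_cos_sq t
    by_cases h : r ≤ δ
    · rw [Set.indicator_of_mem (by simpa [hn] using h), Set.indicator_of_mem (by simpa using h)]
      simp only [hn]
      ext i
      fin_cases i <;> simp [PiLp.inner_apply, Fin.sum_univ_two] <;> field_simp
    · rw [Set.indicator_of_notMem (by simpa [hn] using h),
        Set.indicator_of_notMem (by simpa using h)]
      simp
  rw [setIntegral_congr_fun (measurableSet_Ioi.prod measurableSet_Ioo) hcong,
    Measure.volume_eq_prod, ← Measure.prod_restrict,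
    integral_prod_smul (fun r => (Set.Iic δ).indicator (fun r => r ^ 2 * g r) r)
      (fun t => (w 0 * Real.cos t + w 1 * Real.sin t) •
          (!₂[Real.cos t, Real.sin t] : EuclideanSpace ℝ (Fin 2))),
    rmi_angle, setIntegral_indicator measurableSet_Iic, Set.Ioi_inter_Iic,
    intervalIntegral.integral_of_le hδ.le, smul_smul, mul_comm]
end

section
/- Let k_m > 0, R > 0, and let F_R : ℝ² \ {0} → ℝ² be the spring interaction force F_R(z) = k_m·(z/‖z‖)·(2R − ‖z‖)/R⁴. Then for every w ∈ ℝ², the vector-valued integral ∫_{B_{2R}(0)} F_R(z)·⟨w, z⟩ dz = (4/3)·k_m·π·w, where the integrand is extended by 0 at z = 0. In particular, the value is independent of R, so lim_{R→0} ∫_{B_{2R}(0)} F_R(z)·⟨w, z⟩ dz = (4/3)·k_m·π·w. -/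
open MeasureTheory Filter

lemma aux_angle (w : EuclideanSpace ℝ (Fin 2)) :
    ∫ θ in Set.Ioo (-Real.pi) Real.pi,
      ((w 0 * Real.cos θ + w 1 * Real.sin θ) •
        (!₂[Real.cos θ, Real.sin θ] : EuclideanSpace ℝ (Fin 2))) = Real.pi • w := by
  rw [← integral_Ioc_eq_integral_Ioo,
    ← intervalIntegral.integral_of_le (by linarith [Real.pi_pos])]
  have h : ∀ θ : ℝ, ((w 0 * Real.cos θ + w 1 * Real.sin θ) •
        (!₂[Real.cos θ, Real.sin θ] : EuclideanSpace ℝ (Fin 2)))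
      = (Real.cos θ ^ 2) • (!₂[w 0, 0] : EuclideanSpace ℝ (Fin 2))
        + (Real.sin θ * Real.cos θ) • (!₂[w 1, w 0] : EuclideanSpace ℝ (Fin 2))
        + (Real.sin θ ^ 2) • (!₂[0, w 1] : EuclideanSpace ℝ (Fin 2)) := by
    intro θ
    ext i
    fin_cases i <;> simp <;> ring
  simp_rw [h]
  rw [intervalIntegral.integral_add, intervalIntegral.integral_add,
    intervalIntegral.integral_smul_const, intervalIntegral.integral_smul_const,
    intervalIntegral.integral_smul_const, integral_cos_sq, integral_sin_sq,
    integral_sin_mul_cos₁]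
  · ext i
    fin_cases i <;> simp <;> ring
  all_goals
    apply Continuous.intervalIntegrable
    fun_prop

lemma aux_radial (km R : ℝ) (hR : 0 < R) :
    ∫ r in Set.Ioi (0 : ℝ),
      (Set.Iic (2 * R)).indicator (fun r => km * (2 * R - r) / R ^ 4 * r ^ 2) r
      = 4 / 3 * km := by
  rw [setIntegral_indicator measurableSet_Iic, Set.Ioi_inter_Iic,
    ← intervalIntegral.integral_of_le (by linarith)]
  have h : ∀ r : ℝ, km * (2 * R - r) / R ^ 4 * r ^ 2
      = (km * 2 * R / R ^ 4) * r ^ 2 - (km / R ^ 4) * r ^ 3 := by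
    intro r; ring
  simp_rw [h]
  rw [intervalIntegral.integral_sub, intervalIntegral.integral_const_mul,
    intervalIntegral.integral_const_mul, integral_pow, integral_pow]
  · field_simp
    norm_num
    ring
  all_goals
    apply Continuous.intervalIntegrable
    fun_prop

lemma aux_polar (f : EuclideanSpace ℝ (Fin 2) → EuclideanSpace ℝ (Fin 2)) :
    ∫ z, f z = ∫ p in Set.Ioi (0 : ℝ) ×ˢ Set.Ioo (-Real.pi) Real.pi,
      p.1 • f (!₂[p.1 * Real.cos p.2, p.1 * Real.sin p.2]) := by
  rw [← (PiLp.volume_preserving_toLp (Fin 2)).integral_comp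
      (MeasurableEquiv.toLp 2 (Fin 2 → ℝ)).measurableEmbedding f,
    ← ((volume_preserving_finTwoArrow ℝ).symm).integral_comp
      (MeasurableEquiv.finTwoArrow (α := ℝ)).symm.measurableEmbedding,
    ← integral_comp_polarCoord_symm]
  rfl

lemma aux_main (km R : ℝ) (hR : 0 < R) (w : EuclideanSpace ℝ (Fin 2)) :
    (∫ z in Metric.closedBall (0 : EuclideanSpace ℝ (Fin 2)) (2 * R),
        ((km * (2 * R - ‖z‖) / R ^ 4) * (inner ℝ w z : ℝ) / ‖z‖) • z)
      = ((4 / 3) * km * Real.pi) • w := by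
  rw [← integral_indicator Metric.isClosed_closedBall.measurableSet, aux_polar]
  have key : ∀ p ∈ Set.Ioi (0 : ℝ) ×ˢ Set.Ioo (-Real.pi) Real.pi,
      p.1 • (Metric.closedBall (0 : EuclideanSpace ℝ (Fin 2)) (2 * R)).indicator
        (fun z => ((km * (2 * R - ‖z‖) / R ^ 4) * (inner ℝ w z : ℝ) / ‖z‖) • z)
        (!₂[p.1 * Real.cos p.2, p.1 * Real.sin p.2])
      = (Set.Iic (2 * R)).indicator (fun r => km * (2 * R - r) / R ^ 4 * r ^ 2) p.1 •
        ((w 0 * Real.cos p.2 + w 1 * Real.sin p.2) •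
        (!₂[Real.cos p.2, Real.sin p.2] : EuclideanSpace ℝ (Fin 2))) := by
    rintro ⟨r, θ⟩ ⟨hr, -⟩
    replace hr : 0 < r := hr
    have hn : ‖(!₂[r * Real.cos θ, r * Real.sin θ] : EuclideanSpace ℝ (Fin 2))‖ = r := by
      rw [EuclideanSpace.norm_eq, Real.sqrt_eq_iff_mul_self_eq (by positivity) hr.le]
      simp [Fin.sum_univ_two]
      linear_combination (r ^ 2) * Real.sin_sq_add_cos_sq θ
    have hi : (inner ℝ w (!₂[r * Real.cos θ, r * Real.sin θ] : EuclideanSpace ℝ (Fin 2)) : ℝ)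
        = r * (w 0 * Real.cos θ + w 1 * Real.sin θ) := by
      simp [PiLp.inner_apply, Fin.sum_univ_two]
      ring
    have hs : (!₂[r * Real.cos θ, r * Real.sin θ] : EuclideanSpace ℝ (Fin 2))
        = r • !₂[Real.cos θ, Real.sin θ] := by
      ext i; fin_cases i <;> simp
    by_cases h : r ≤ 2 * R
    · rw [Set.indicator_of_mem (by rw [mem_closedBall_zero_iff]; exact hn.trans_le h),
        Set.indicator_of_mem (by exact h), hn, hi, hs, smul_smul, smul_smul, smul_smul]
      congr 1
      field_simp
    · rw [Set.indicator_of_notMem (by rw [mem_closedBall_zero_iff]; simpa [hn] using h),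
        Set.indicator_of_notMem (by exact h)]
      simp
  rw [setIntegral_congr_fun (measurableSet_Ioi.prod measurableSet_Ioo) key,
    Measure.volume_eq_prod, ← Measure.prod_restrict,
    integral_prod_smul (fun r => (Set.Iic (2 * R)).indicator
      (fun r => km * (2 * R - r) / R ^ 4 * r ^ 2) r)
      (fun θ => (w 0 * Real.cos θ + w 1 * Real.sin θ) •
        (!₂[Real.cos θ, Real.sin θ] : EuclideanSpace ℝ (Fin 2))), aux_angle, aux_radial km R hR, smul_smul]

/-- For the spring interaction force `F_R(z) = k_m (z/‖z‖)(2R-‖z‖)/R⁴`, the integral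
`∫_{B_{2R}(0)} F_R(z) ⟨w,z⟩ dz = (4/3) k_m π w`, independently of `R`; in particular the
limit as `R → 0⁺` equals `(4/3) k_m π w`. -/
theorem spring_force_integral (km R : ℝ) (hkm : 0 < km) (hR : 0 < R)
    (w : EuclideanSpace ℝ (Fin 2)) :
    (∫ z in Metric.closedBall (0 : EuclideanSpace ℝ (Fin 2)) (2 * R),
        ((km * (2 * R - ‖z‖) / R ^ 4) * (inner ℝ w z : ℝ) / ‖z‖) • z)
      = ((4 / 3) * km * Real.pi) • w ∧
    Tendsto (fun R' : ℝ =>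
        ∫ z in Metric.closedBall (0 : EuclideanSpace ℝ (Fin 2)) (2 * R'),
          ((km * (2 * R' - ‖z‖) / R' ^ 4) * (inner ℝ w z : ℝ) / ‖z‖) • z)
      (nhdsWithin 0 (Set.Ioi 0)) (nhds (((4 / 3) * km * Real.pi) • w)) := by
  refine ⟨aux_main km R hR w, ?_⟩
  refine tendsto_const_nhds.congr' ?_
  filter_upwards [self_mem_nhdsWithin] with R' hR'
  exact (aux_main km R' hR' w).symm
end
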